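/- arXiv:1605.09345 — 7 statements merged into one kernel-verified Lean document; each statement's English description precedes it below -/
import Mathlib

section
/- For every ordinal α, the semigroup of all order isomorphisms between principal upper sets of the ordinal ω^α (with the operation of composition of partial maps) is isomorphic, as a semigroup, to the α-bicyclic monoid B_α. Concretely, every principal upper set of ω^α is an interval [a, ω^α) for some a < ω^α, for any a, b < ω^α there is a unique order isomorphism f_{a,b} : [a, ω^α) → [b, ω^α), and the map sending f_{a,b} to the pair (a,b) is a semigroup isomorphism onto B_α. -/
open Ordinal

/-- The `α`-bicyclic monoid `B_α`: the set of pairs `(a, b)` of ordinals with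
`a, b < ω ^ α`. -/
def Balpha (α : Ordinal) : Type _ :=
  {p : Ordinal × Ordinal // p.1 < omega0 ^ α ∧ p.2 < omega0 ^ α}

/-- Multiplication of the `α`-bicyclic monoid:
`(a,b) * (c,d) = (a + (c - b), d)` if `b ≤ c`, and `(a, d + (b - c))` if `c < b`,
where `x - y` is the unique ordinal `z` with `y + z = x` (for `y ≤ x`). -/
noncomputable instance (α : Ordinal) : Mul (Balpha α) :=
  ⟨fun x y =>
    if _ : x.1.2 ≤ y.1.1 then
      ⟨(x.1.1 + (y.1.1 - x.1.2), y.1.2),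
        principal_add_omega0_opow α x.2.1
          (lt_of_le_of_lt (Ordinal.sub_le_self _ _) y.2.1), y.2.2⟩
    else
      ⟨(x.1.1, y.1.2 + (x.1.2 - y.1.1)), x.2.1,
        principal_add_omega0_opow α y.2.2
          (lt_of_le_of_lt (Ordinal.sub_le_self _ _) x.2.2)⟩⟩

/-- A convenient constructor for elements of `B_α`. -/
def Balpha.mk (α : Ordinal) (a b : Ordinal) (ha : a < omega0 ^ α) (hb : b < omega0 ^ α) :
    Balpha α := ⟨(a, b), ha, hb⟩

/-- The graph (as a partial map on ordinals) of an order isomorphism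
`f : [a, ω^α) → [b, ω^α)` between principal upper sets of `ω^α`. -/
def upGraph (α a b : Ordinal)
    (f : (Set.Ico a (omega0 ^ α)) ≃o (Set.Ico b (omega0 ^ α))) :
    Ordinal → Ordinal → Prop :=
  fun x y => ∃ hx : x ∈ Set.Ico a (omega0 ^ α), ((f ⟨x, hx⟩ : Ordinal) = y)

namespace Balpha

/-- The canonical order isomorphism `x ↦ b + (x - a)` from `[a, ω^α)` to `[b, ω^α)`. -/
noncomputable def icoIso (α a b : Ordinal) (ha : a < omega0 ^ α) (hb : b < omega0 ^ α) :
    (Set.Ico a (omega0 ^ α)) ≃o (Set.Ico b (omega0 ^ α)) where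
  toFun x := ⟨b + (x - a), le_self_add,
    isPrincipal_add_omega0_opow α hb ((Ordinal.sub_le_self _ _).trans_lt x.2.2)⟩
  invFun y := ⟨a + (y - b), le_self_add,
    isPrincipal_add_omega0_opow α ha ((Ordinal.sub_le_self _ _).trans_lt y.2.2)⟩
  left_inv x := Subtype.ext <| by
    simp [Ordinal.add_sub_cancel_of_le x.2.1]
  right_inv y := Subtype.ext <| by
    simp [Ordinal.add_sub_cancel_of_le y.2.1]
  map_rel_iff' {x y} := by
    change b + (x.1 - a) ≤ b + (y.1 - a) ↔ x.1 ≤ y.1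
    rw [add_le_add_iff_left, ← add_le_add_iff_left a, Ordinal.add_sub_cancel_of_le x.2.1,
      Ordinal.add_sub_cancel_of_le y.2.1]

theorem upGraph_iff {α a b : Ordinal} (ha : a < omega0 ^ α) (hb : b < omega0 ^ α)
    (f : (Set.Ico a (omega0 ^ α)) ≃o (Set.Ico b (omega0 ^ α))) (x y : Ordinal) :
    upGraph α a b f x y ↔ (a ≤ x ∧ x < omega0 ^ α) ∧ b + (x - a) = y := by
  obtain rfl : f = icoIso α a b ha hb := Subsingleton.elim _ _
  exact ⟨fun ⟨hx, h⟩ => ⟨hx, h⟩, fun ⟨hx, h⟩ => ⟨hx, h⟩⟩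

theorem mk_mul_mk_of_le {α a b c d : Ordinal} (ha : a < omega0 ^ α) (hb : b < omega0 ^ α)
    (hc : c < omega0 ^ α) (hd : d < omega0 ^ α) (h : b ≤ c) :
    (mk α a b ha hb * mk α c d hc hd).1 = (a + (c - b), d) :=
  congrArg Subtype.val (dif_pos h)

theorem mk_mul_mk_of_lt {α a b c d : Ordinal} (ha : a < omega0 ^ α) (hb : b < omega0 ^ α)
    (hc : c < omega0 ^ α) (hd : d < omega0 ^ α) (h : c < b) :
    (mk α a b ha hb * mk α c d hc hd).1 = (a, d + (b - c)) :=
  congrArg Subtype.val (dif_neg h.not_ge)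

end Balpha

/-- The semigroup of all order isomorphisms between principal upper sets of `ω^α`
(under composition of partial maps) is isomorphic to the `α`-bicyclic monoid `B_α`.
Concretely: every principal upper set of `ω^α` is an interval `[a, ω^α)` with
`a < ω^α`; for all `a, b < ω^α` there is a unique order isomorphism
`f_{a,b} : [a, ω^α) → [b, ω^α)` (so that `f_{a,b} ↦ (a,b)` is a bijection onto `B_α`);
and this bijection is multiplicative: whenever an order isomorphism
`h : [e, ω^α) → [e', ω^α)` is, as a partial map, the composition of
`f : [a, ω^α) → [b, ω^α)` followed by `g : [c, ω^α) → [d, ω^α)`, then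
`(e, e') = (a, b) * (c, d)` in `B_α`. -/
theorem upperIso_semigroup_iso_Balpha (α : Ordinal) :
    (∀ x : Ordinal, x < omega0 ^ α →
      {y : Ordinal | x ≤ y ∧ y < omega0 ^ α} = Set.Ico x (omega0 ^ α)) ∧
    (∀ a b : Ordinal, a < omega0 ^ α → b < omega0 ^ α →
      ∃! _ : (Set.Ico a (omega0 ^ α)) ≃o (Set.Ico b (omega0 ^ α)), True) ∧
    (∀ (a b c d e e' : Ordinal)
      (ha : a < omega0 ^ α) (hb : b < omega0 ^ α) (hc : c < omega0 ^ α)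
      (hd : d < omega0 ^ α) (he : e < omega0 ^ α) (he' : e' < omega0 ^ α)
      (f : (Set.Ico a (omega0 ^ α)) ≃o (Set.Ico b (omega0 ^ α)))
      (g : (Set.Ico c (omega0 ^ α)) ≃o (Set.Ico d (omega0 ^ α)))
      (h : (Set.Ico e (omega0 ^ α)) ≃o (Set.Ico e' (omega0 ^ α))),
      (∀ x z : Ordinal,
        upGraph α e e' h x z ↔ ∃ y : Ordinal, upGraph α a b f x y ∧ upGraph α c d g y z) →
      Balpha.mk α e e' he he' = Balpha.mk α a b ha hb * Balpha.mk α c d hc hd) := by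
  refine ⟨fun x _ => rfl, fun a b ha hb =>
    ⟨Balpha.icoIso α a b ha hb, trivial, fun _ _ => Subsingleton.elim _ _⟩, ?_⟩
  intro a b c d e e' ha hb hc hd he he' f g h H
  simp only [Balpha.upGraph_iff ha hb, Balpha.upGraph_iff hc hd, Balpha.upGraph_iff he he'] at H
  obtain ⟨y, ⟨⟨hae, -⟩, hy⟩, ⟨hcy, -⟩, hz⟩ := (H e e').1 ⟨⟨le_rfl, he⟩, by simp⟩
  apply Subtype.ext
  rcases le_or_gt b c with hbc | hcb
  · rw [Balpha.mk_mul_mk_of_le _ _ _ _ hbc]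
    have hlt : a + (c - b) < omega0 ^ α :=
      isPrincipal_add_omega0_opow α ha ((Ordinal.sub_le_self _ _).trans_lt hc)
    have hle : e ≤ a + (c - b) := by
      refine ((H (a + (c - b)) d).2 ⟨c, ⟨⟨le_self_add, hlt⟩, ?_⟩, ⟨le_rfl, hc⟩, by simp⟩).1.1
      rw [Ordinal.add_sub_cancel, Ordinal.add_sub_cancel_of_le hbc]
    have hge : a + (c - b) ≤ e := by
      rwa [← Ordinal.add_sub_cancel_of_le hae, add_le_add_iff_left, Ordinal.sub_le, hy]
    obtain rfl : e = a + (c - b) := hle.antisymm hge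
    rw [Ordinal.add_sub_cancel, Ordinal.add_sub_cancel_of_le hbc] at hy
    subst hy
    simpa [Balpha.mk] using hz.symm
  · rw [Balpha.mk_mul_mk_of_lt _ _ _ _ hcb]
    have hle : e ≤ a :=
      ((H a (d + (b - c))).2 ⟨b, ⟨⟨le_rfl, ha⟩, by simp⟩, ⟨hcb.le, hb⟩, rfl⟩).1.1
    obtain rfl : e = a := hle.antisymm hae
    rw [Ordinal.sub_self, add_zero] at hy
    subst hy
    exact congrArg (Prod.mk e) hz.symm
end

section
/- Let α be an ordinal and let τ be a Hausdorff topology on the α-bicyclic monoid B_α for which multiplication is separately continuous (i.e., (B_α, τ) is a semitopological semigroup). Then for every ordinal a < ω^α, the elements (0,a) and (a,0) are isolated points of (B_α, τ). -/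
open Ordinal

theorem Balpha.mul_val_of_le {α : Ordinal} {x y : Balpha α} (h : x.1.2 ≤ y.1.1) :
    (x * y).1 = (x.1.1 + (y.1.1 - x.1.2), y.1.2) :=
  congrArg Subtype.val (dif_pos h)

theorem Balpha.mul_val_of_lt {α : Ordinal} {x y : Balpha α} (h : y.1.1 < x.1.2) :
    (x * y).1 = (x.1.1, y.1.2 + (x.1.2 - y.1.1)) :=
  congrArg Subtype.val (dif_neg h.not_ge)

theorem Balpha.eq_iff {α : Ordinal} {x y : Balpha α} :
    x = y ↔ x.1.1 = y.1.1 ∧ x.1.2 = y.1.2 :=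
  Subtype.ext_iff.trans Prod.ext_iff

theorem Balpha.mk_val {α a b : Ordinal} (ha : a < omega0 ^ α) (hb : b < omega0 ^ α) :
    (Balpha.mk α a b ha hb).1 = (a, b) :=
  rfl

/-- Left multiplication by `(0, a)` sends only `(a, 0)` to the identity. -/
theorem Balpha.zero_left_mul_eq_one_iff {α : Ordinal} (a : Ordinal) (ha : a < omega0 ^ α)
    (h0 : 0 < omega0 ^ α) (x : Balpha α) :
    Balpha.mk α 0 a h0 ha * x = Balpha.mk α 0 0 h0 h0 ↔ x = Balpha.mk α a 0 ha h0 := by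
  rw [Balpha.eq_iff, Balpha.eq_iff]
  rcases le_or_gt a x.1.1 with h | h
  · rw [Balpha.mul_val_of_le (x := Balpha.mk α 0 a h0 ha) h]
    simp only [Balpha.mk_val, zero_add, Ordinal.sub_eq_zero_iff_le]
    exact and_congr_left' ⟨fun h' => le_antisymm h' h, le_of_eq⟩
  · rw [Balpha.mul_val_of_lt (x := Balpha.mk α 0 a h0 ha) h]
    simp only [Balpha.mk_val, Ordinal.add_eq_zero_iff, Ordinal.sub_eq_zero_iff_le]
    exact ⟨fun h' => absurd h'.2.2 h.not_ge, fun h' => absurd h'.1 h.ne⟩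

/-- Right multiplication by `(a, 0)` sends only `(0, a)` to the identity. -/
theorem Balpha.mul_zero_right_eq_one_iff {α : Ordinal} (a : Ordinal) (ha : a < omega0 ^ α)
    (h0 : 0 < omega0 ^ α) (x : Balpha α) :
    x * Balpha.mk α a 0 ha h0 = Balpha.mk α 0 0 h0 h0 ↔ x = Balpha.mk α 0 a h0 ha := by
  rw [Balpha.eq_iff, Balpha.eq_iff]
  rcases le_or_gt x.1.2 a with h | h
  · rw [Balpha.mul_val_of_le (y := Balpha.mk α a 0 ha h0) h]
    simp only [Balpha.mk_val, Ordinal.add_eq_zero_iff, Ordinal.sub_eq_zero_iff_le, and_true]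
    exact and_congr_right' ⟨fun h' => le_antisymm h h', ge_of_eq⟩
  · rw [Balpha.mul_val_of_lt (y := Balpha.mk α a 0 ha h0) h]
    simp only [Balpha.mk_val, zero_add, Ordinal.sub_eq_zero_iff_le]
    exact ⟨fun h' => absurd h'.2 h.not_ge, fun h' => absurd h'.2 h.ne'⟩

theorem Balpha.one_one_mul_eq_self_iff {α : Ordinal} (h1 : 1 < omega0 ^ α) (x : Balpha α) :
    Balpha.mk α 1 1 h1 h1 * x = x ↔ x.1.1 ≠ 0 := by
  rw [Balpha.eq_iff, ← Order.one_le_iff_ne_zero]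
  rcases le_or_gt 1 x.1.1 with h | h
  · rw [Balpha.mul_val_of_le (x := Balpha.mk α 1 1 h1 h1) h]
    simp [Balpha.mk_val, h, Ordinal.add_sub_cancel_of_le h]
  · rw [Balpha.mul_val_of_lt (x := Balpha.mk α 1 1 h1 h1) h]
    exact ⟨fun h' => h'.1.le, fun h' => absurd h' h.not_ge⟩

theorem Balpha.mul_one_one_eq_self_iff {α : Ordinal} (h1 : 1 < omega0 ^ α) (x : Balpha α) :
    x * Balpha.mk α 1 1 h1 h1 = x ↔ x.1.2 ≠ 0 := by
  rw [Balpha.eq_iff, ← Order.one_le_iff_ne_zero]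
  rcases le_or_gt x.1.2 1 with h | h
  · rw [Balpha.mul_val_of_le (y := Balpha.mk α 1 1 h1 h1) h]
    simp only [Balpha.mk_val]
    refine ⟨fun h' => h'.2.le, fun h' => ?_⟩
    simp [le_antisymm h h']
  · rw [Balpha.mul_val_of_lt (y := Balpha.mk α 1 1 h1 h1) h]
    simp [Balpha.mk_val, h.le, Ordinal.add_sub_cancel_of_le h.le]

/-- The identity of a semitopological `α`-bicyclic monoid is an isolated point. -/
theorem Balpha.isOpen_singleton_one {α : Ordinal} [TopologicalSpace (Balpha α)]
    [T2Space (Balpha α)]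
    (hl : ∀ s : Balpha α, Continuous fun x => s * x)
    (hr : ∀ s : Balpha α, Continuous fun x => x * s) (h0 : 0 < omega0 ^ α) :
    IsOpen {Balpha.mk α 0 0 h0 h0} := by
  rcases eq_or_ne α 0 with rfl | hα
  · convert isOpen_univ
    refine Set.eq_univ_of_forall fun ⟨⟨c, d⟩, hc, hd⟩ => Subtype.ext ?_
    simp only [opow_zero, Order.lt_one_iff] at hc hd
    simp [Balpha.mk, hc, hd]
  · have h1 : 1 < omega0 ^ α :=
      Ordinal.one_lt_omega0.trans_le (left_le_opow _ (pos_iff_ne_zero.2 hα))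
    have hL := isClosed_eq (hl (Balpha.mk α 1 1 h1 h1)) continuous_id
    have hR := isClosed_eq (hr (Balpha.mk α 1 1 h1 h1)) continuous_id
    convert (hL.union hR).isOpen_compl
    ext x
    simp only [Set.mem_singleton_iff, Set.mem_compl_iff, Set.mem_union, Set.mem_ofPred_eq, id,
      Balpha.one_one_mul_eq_self_iff, Balpha.mul_one_one_eq_self_iff, not_or, not_not]
    exact Balpha.eq_iff

/-- For a semitopological `α`-bicyclic monoid `(B_α, τ)` (Hausdorff, separately
continuous multiplication), for every ordinal `a < ω ^ α` the elements `(0, a)` and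
`(a, 0)` are isolated points. -/
theorem isolated_zero_pairs (α : Ordinal) [TopologicalSpace (Balpha α)] [T2Space (Balpha α)]
    (hl : ∀ s : Balpha α, Continuous fun x => s * x)
    (hr : ∀ s : Balpha α, Continuous fun x => x * s)
    (a : Ordinal) (ha : a < omega0 ^ α) :
    IsOpen {Balpha.mk α 0 a (opow_pos α omega0_pos) ha} ∧
    IsOpen {Balpha.mk α a 0 ha (opow_pos α omega0_pos)} := by
  have h0 : 0 < omega0 ^ α := opow_pos α omega0_pos
  have hone := Balpha.isOpen_singleton_one hl hr h0
  constructor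
  · convert hone.preimage (hr (Balpha.mk α a 0 ha h0))
    ext x
    exact (Balpha.mul_zero_right_eq_one_iff a ha h0 x).symm
  · convert hone.preimage (hl (Balpha.mk α 0 a h0 ha))
    ext x
    exact (Balpha.zero_left_mul_eq_one_iff a ha h0 x).symm
end

section
/- Let α be an ordinal and let τ be a Hausdorff topology on the α-bicyclic monoid B_α for which multiplication is separately continuous. Then for every element (a,b) ∈ B_α there exists a clopen neighborhood V of (a,b) in (B_α, τ) such that: (1) every (c,d) ∈ V satisfies c ≤ a and d ≤ b; and (2) for every (c,d) ∈ V, a = c if and only if b = d. -/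
open Ordinal

namespace Balpha

variable {α : Ordinal}

theorem mul_val_of_le_s2 {x y : Balpha α} (h : x.1.2 ≤ y.1.1) :
    (x * y).1 = (x.1.1 + (y.1.1 - x.1.2), y.1.2) := by
  exact congrArg Subtype.val (dif_pos h)

theorem mul_val_of_lt_s2 {x y : Balpha α} (h : y.1.1 < x.1.2) :
    (x * y).1 = (x.1.1, y.1.2 + (x.1.2 - y.1.1)) := by
  exact congrArg Subtype.val (dif_neg h.not_ge)

/-- Multiplying by the idempotent `(c, c)` on the left fixes exactly the pairs with first
coordinate at least `c`. -/
theorem mk_self_mul_eq_iff {c : Ordinal} (hc : c < omega0 ^ α) (y : Balpha α) :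
    mk α c c hc hc * y = y ↔ c ≤ y.1.1 := by
  rcases le_or_gt c y.1.1 with h | h
  · refine iff_of_true (Subtype.ext ?_) h
    rw [mul_val_of_le_s2 (x := mk α c c hc hc) h]
    exact Prod.ext (Ordinal.add_sub_cancel_of_le h) rfl
  · refine iff_of_false (fun e => ?_) h.not_ge
    have e' := congrArg (fun z : Balpha α => z.1.1) e
    simp only [mul_val_of_lt_s2 (x := mk α c c hc hc) h] at e'
    exact h.ne' e'

/-- Multiplying by the idempotent `(c, c)` on the right fixes exactly the pairs with second
coordinate at least `c`. -/
theorem mul_mk_self_eq_iff {c : Ordinal} (hc : c < omega0 ^ α) (y : Balpha α) :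
    y * mk α c c hc hc = y ↔ c ≤ y.1.2 := by
  rcases lt_or_ge c y.1.2 with h | h
  · refine iff_of_true (Subtype.ext ?_) h.le
    rw [mul_val_of_lt_s2 (y := mk α c c hc hc) h]
    exact Prod.ext rfl (Ordinal.add_sub_cancel_of_le h.le)
  · have e := mul_val_of_le_s2 (y := mk α c c hc hc) h
    constructor
    · intro e'
      rw [e'] at e
      exact (congrArg Prod.snd e).ge
    · intro h'
      have hcy : c = y.1.2 := le_antisymm h' h
      refine Subtype.ext (e.trans (Prod.ext ?_ hcy))
      change y.1.1 + (c - y.1.2) = y.1.1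
      rw [← hcy, Ordinal.sub_self, add_zero]

/-- The identity `(0, 0)` is an isolated point of `B_α`. -/
theorem isClopen_setOf_val_eq_zero [TopologicalSpace (Balpha α)] [T2Space (Balpha α)]
    (hl : ∀ s : Balpha α, Continuous fun x => s * x)
    (hr : ∀ s : Balpha α, Continuous fun x => x * s) :
    IsClopen {y : Balpha α | y.1 = (0, 0)} := by
  constructor
  · exact Set.Subsingleton.isClosed fun y hy z hz => Subtype.ext (hy.trans hz.symm)
  · by_cases h1 : (1 : Ordinal) < omega0 ^ α
    · have h := (isClosed_eq (hl (mk α 1 1 h1 h1)) continuous_id).union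
        (isClosed_eq (hr (mk α 1 1 h1 h1)) continuous_id)
      convert h.isOpen_compl using 1
      ext y
      simp [mk_self_mul_eq_iff, mul_mk_self_eq_iff, Prod.ext_iff]
    · convert isOpen_univ
      ext y
      have h0 : ∀ c : Ordinal, c < omega0 ^ α → c = 0 := fun c hc =>
        Order.lt_one_iff.mp (hc.trans_le (not_lt.mp h1))
      simp [Prod.ext_iff, h0 _ y.2.1, h0 _ y.2.2]

/-- The pairs `y` with `(0, a) * y * (b, 0) = (0, 0)`. -/
theorem mul_mul_val_eq_zero {a b : Ordinal} (h0 : 0 < omega0 ^ α) (ha : a < omega0 ^ α)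
    (hb : b < omega0 ^ α) (y : Balpha α) :
    (mk α 0 a h0 ha * y * mk α b 0 hb h0).1 = (0, 0) ↔
      y.1.1 ≤ a ∧ y.1.2 + (a - y.1.1) = b := by
  have key : ∀ z : Balpha α,
      (z * mk α b 0 hb h0).1 = (0, 0) ↔ z.1.1 = 0 ∧ z.1.2 = b := by
    intro z
    rcases le_or_gt z.1.2 b with h | h
    · rw [mul_val_of_le_s2 (y := mk α b 0 hb h0) h]
      change (z.1.1 + (b - z.1.2), (0 : Ordinal)) = (0, 0) ↔ _
      have hz : z.1.2 = b ↔ b ≤ z.1.2 := ⟨fun e => e.ge, fun e => h.antisymm e⟩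
      simp [Prod.ext_iff, Ordinal.sub_eq_zero_iff_le, hz]
    · rw [mul_val_of_lt_s2 (y := mk α b 0 hb h0) h]
      change (z.1.1, 0 + (z.1.2 - b)) = (0, 0) ↔ _
      simp [Prod.ext_iff, Ordinal.sub_eq_zero_iff_le, h.ne', h]
  rw [key]
  rcases le_or_gt a y.1.1 with h | h
  · rw [mul_val_of_le_s2 (x := mk α 0 a h0 ha) h]
    change 0 + (y.1.1 - a) = 0 ∧ y.1.2 = b ↔ _
    simp [Ordinal.sub_eq_zero_iff_le, Ordinal.sub_eq_zero_iff_le.mpr h]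
  · rw [mul_val_of_lt_s2 (x := mk α 0 a h0 ha) h]
    change (0 : Ordinal) = 0 ∧ y.1.2 + (a - y.1.1) = b ↔ _
    simp [h.le]

end Balpha

/-- For a semitopological `α`-bicyclic monoid `(B_α, τ)` (Hausdorff, separately
continuous multiplication), every element `(a, b)` has a clopen neighborhood `V` such
that every `(c, d) ∈ V` satisfies `c ≤ a` and `d ≤ b`, and for every `(c, d) ∈ V`
one has `a = c` if and only if `b = d`. -/
theorem exists_clopen_nhd (α : Ordinal) [TopologicalSpace (Balpha α)] [T2Space (Balpha α)]
    (hl : ∀ s : Balpha α, Continuous fun x => s * x)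
    (hr : ∀ s : Balpha α, Continuous fun x => x * s)
    (x : Balpha α) :
    ∃ V : Set (Balpha α), IsClopen V ∧ x ∈ V ∧
      (∀ y ∈ V, y.1.1 ≤ x.1.1 ∧ y.1.2 ≤ x.1.2) ∧
      (∀ y ∈ V, x.1.1 = y.1.1 ↔ x.1.2 = y.1.2) := by
  obtain ⟨⟨a, b⟩, ha, hb⟩ := x
  have h0 : 0 < omega0 ^ α := (zero_le (a := a)).trans_lt ha
  have mem := Balpha.mul_mul_val_eq_zero h0 ha hb
  refine ⟨{y | (Balpha.mk α 0 a h0 ha * y * Balpha.mk α b 0 hb h0).1 = (0, 0)},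
    (Balpha.isClopen_setOf_val_eq_zero hl hr).preimage ((hr _).comp (hl _)),
    (mem _).mpr ?_, fun y hy => ?_, fun y hy => ?_⟩
  · simp
  · obtain ⟨h, e⟩ := (mem y).mp hy
    exact ⟨h, le_self_add.trans_eq e⟩
  · obtain ⟨h, e⟩ := (mem y).mp hy
    change a = y.1.1 ↔ b = y.1.2
    change y.1.2 + (a - y.1.1) = b at e
    rw [← e, add_eq_left, Ordinal.sub_eq_zero_iff_le]
    exact ⟨fun e => e.le, fun e => e.antisymm h⟩
end

section
/- Let α be an ordinal and let τ be a Hausdorff topology on the α-bicyclic monoid B_α for which multiplication is separately continuous. Then for all finite ordinals n and m (i.e., n, m < ω), the element (n,m) is an isolated point of (B_α, τ). -/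
open Ordinal

namespace Balpha

theorem mul_val (α : Ordinal) (x y : Balpha α) :
    (x * y).1 = if x.1.2 ≤ y.1.1 then (x.1.1 + (y.1.1 - x.1.2), y.1.2)
      else (x.1.1, y.1.2 + (x.1.2 - y.1.1)) := by
  change Subtype.val (dite _ _ _) = _
  split_ifs <;> rfl

/-- Left multiplication by the idempotent `(k, k)` fixes exactly the pairs `(c, d)` with `k ≤ c`. -/
theorem idem_mul_eq_iff {α k : Ordinal} (hk : k < omega0 ^ α) (x : Balpha α) :
    mk α k k hk hk * x = x ↔ k ≤ x.1.1 := by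
  refine Subtype.ext_iff.trans ?_
  rw [mul_val]
  change (if k ≤ x.1.1 then (k + (x.1.1 - k), x.1.2) else (k, x.1.2 + (k - x.1.1))) = x.1 ↔ _
  split_ifs with h
  · simp [h, Ordinal.add_sub_cancel_of_le h]
  · simp only [h, iff_false]
    intro e
    exact h (congrArg Prod.fst e).le

/-- Right multiplication by the idempotent `(k, k)` fixes exactly the pairs `(a, b)` with `k ≤ b`. -/
theorem mul_idem_eq_iff {α k : Ordinal} (hk : k < omega0 ^ α) (x : Balpha α) :
    x * mk α k k hk hk = x ↔ k ≤ x.1.2 := by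
  refine Subtype.ext_iff.trans ?_
  rw [mul_val]
  change (if x.1.2 ≤ k then (x.1.1 + (k - x.1.2), k) else (x.1.1, k + (x.1.2 - k))) = x.1 ↔ _
  split_ifs with h
  · constructor
    · intro e
      exact (congrArg Prod.snd e).le
    · intro h'
      obtain rfl := le_antisymm h h'
      simp
  · have h' := (not_le.mp h).le
    simp [h', Ordinal.add_sub_cancel_of_le h']

theorem finite_setOf_lt_natCast (α : Ordinal) (k l : ℕ) :
    {x : Balpha α | x.1.1 < k ∧ x.1.2 < l}.Finite := by
  have hfin (j : ℕ) : (Set.Iio (j : Ordinal)).Finite := by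
    refine ((Set.finite_Iio j).image (Nat.cast : ℕ → Ordinal)).subset fun o ho => ?_
    obtain ⟨i, rfl⟩ := Ordinal.lt_omega0.mp (lt_trans ho (Ordinal.natCast_lt_omega0 j))
    exact ⟨i, Nat.cast_lt.mp (Set.mem_Iio.mp ho), rfl⟩
  exact ((hfin k).prod (hfin l)).preimage Subtype.val_injective.injOn

end Balpha

/-- For a semitopological `α`-bicyclic monoid `(B_α, τ)` (Hausdorff, separately
continuous multiplication), for all finite ordinals `n, m` the element `(n, m)` is an
isolated point. -/
theorem isolated_finite_pairs (α : Ordinal) [TopologicalSpace (Balpha α)] [T2Space (Balpha α)]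
    (hl : ∀ s : Balpha α, Continuous fun x => s * x)
    (hr : ∀ s : Balpha α, Continuous fun x => x * s)
    (n m : ℕ) (hn : (n : Ordinal) < omega0 ^ α) (hm : (m : Ordinal) < omega0 ^ α) :
    IsOpen {Balpha.mk α n m hn hm} := by
  rcases eq_or_ne α 0 with rfl | hα
  · have : Subsingleton (Balpha 0) := ⟨fun x y => by
      obtain ⟨⟨a, b⟩, ha, hb⟩ := x
      obtain ⟨⟨c, d⟩, hc, hd⟩ := y
      simp only [opow_zero, Order.lt_one_iff] at ha hb hc hd
      exact Subtype.ext (by simp [ha, hb, hc, hd])⟩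
    exact isOpen_discrete _
  have hnat (k : ℕ) : (k : Ordinal) < omega0 ^ α :=
    (natCast_lt_omega0 k).trans_le (left_le_opow _ (pos_iff_ne_zero.mpr hα))
  have hopen : IsOpen {x : Balpha α | x.1.1 < (n + 1 : ℕ) ∧ x.1.2 < (m + 1 : ℕ)} := by
    have h₁ := isOpen_ne_fun (hl (Balpha.mk α _ _ (hnat (n + 1)) (hnat (n + 1)))) continuous_id
    have h₂ := isOpen_ne_fun (hr (Balpha.mk α _ _ (hnat (m + 1)) (hnat (m + 1)))) continuous_id
    convert h₁.inter h₂ using 1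
    ext x
    simp only [Set.mem_inter_iff, Set.mem_ofPred_eq, id, ne_eq, Balpha.idem_mul_eq_iff,
      Balpha.mul_idem_eq_iff, not_le]
  have hmem : Balpha.mk α n m hn hm ∈
      {x : Balpha α | x.1.1 < (n + 1 : ℕ) ∧ x.1.2 < (m + 1 : ℕ)} :=
    ⟨Nat.cast_lt.mpr n.lt_succ_self, Nat.cast_lt.mpr m.lt_succ_self⟩
  have hfin := (Balpha.finite_setOf_lt_natCast α (n + 1) (m + 1)).subset
    (Set.sdiff_subset (t := {Balpha.mk α n m hn hm}))
  have := hopen.sdiff hfin.isClosed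
  rwa [Set.sdiff_sdiff_cancel_left (Set.singleton_subset_iff.mpr hmem)] at this
end

section
/- Let α be an ordinal with α ≥ 2 (so that ω < ω^α). The subset {(n,m) : n, m < ω} ∪ {(ω,ω)} of the α-bicyclic monoid B_α is closed under the multiplication of B_α, and with the induced operation it is isomorphic to the bicyclic monoid with an adjoined zero, where (ω,ω) is the zero element. -/
open Ordinal

/-- The bicyclic monoid: `ℕ × ℕ` with `(k,l)·(m,n) = (k+m−min(l,m), l+n−min(l,m))`. -/
def Bicyclic : Type := ℕ × ℕ

instance : Mul Bicyclic :=
  ⟨fun p q => (p.1 + q.1 - min p.2 q.1, p.2 + q.2 - min p.2 q.1)⟩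

lemma omega0_lt_opow_of_two_le {α : Ordinal} (hα : 2 ≤ α) : omega0 < omega0 ^ α := by
  have h1 : (1 : Ordinal) < α := lt_of_lt_of_le one_lt_two hα
  have h2 := (opow_lt_opow_iff_right one_lt_omega0).2 h1
  rwa [opow_one] at h2

/-- The subset `{(n,m) : n, m < ω} ∪ {(ω,ω)}` of `B_α`. -/
def bicSub (α : Ordinal) : Set (Balpha α) :=
  {x | (x.1.1 < omega0 ∧ x.1.2 < omega0) ∨ x.1 = (omega0, omega0)}

lemma Balpha.val_mul {α : Ordinal} (x y : Balpha α) :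
    (x * y).1 = if x.1.2 ≤ y.1.1 then (x.1.1 + (y.1.1 - x.1.2), y.1.2)
      else (x.1.1, y.1.2 + (x.1.2 - y.1.1)) := by
  by_cases h : x.1.2 ≤ y.1.1
  · rw [if_pos h]
    exact congrArg Subtype.val (dif_pos h)
  · rw [if_neg h]
    exact congrArg Subtype.val (dif_neg h)

lemma Bicyclic.mul_def (p q : Bicyclic) :
    p * q = (p.1 + q.1 - min p.2 q.1, p.2 + q.2 - min p.2 q.1) := rfl

lemma Ordinal.natCast_add_omega0_sub_natCast (m n : ℕ) :
    (m : Ordinal) + (omega0 - n) = omega0 := by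
  rw [sub_eq_of_add_eq (natCast_add_omega0 n), natCast_add_omega0]

/-- The pair of ordinals corresponding to an element of the bicyclic monoid with zero. -/
noncomputable def bicPair : WithZero Bicyclic → Ordinal × Ordinal
  | none => (omega0, omega0)
  | some p => ((p.1 : Ordinal), (p.2 : Ordinal))

lemma bicPair_zero : bicPair 0 = (omega0, omega0) := rfl

lemma bicPair_coe (p : Bicyclic) : bicPair p = ((p.1 : Ordinal), (p.2 : Ordinal)) := rfl

lemma bicPair_injective : Function.Injective bicPair := by
  intro p q h
  induction p with
  | zero =>
    induction q with
    | zero => rfl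
    | coe q =>
      rw [bicPair_zero, bicPair_coe, Prod.mk.injEq] at h
      exact absurd h.1 (natCast_lt_omega0 _).ne'
  | coe p =>
    induction q with
    | zero =>
      rw [bicPair_zero, bicPair_coe, Prod.mk.injEq] at h
      exact absurd h.1 (natCast_lt_omega0 _).ne
    | coe q =>
      rw [bicPair_coe, bicPair_coe, Prod.mk.injEq, Nat.cast_inj, Nat.cast_inj] at h
      exact congrArg _ (Prod.ext h.1 h.2)

lemma bicPair_mul (p q : WithZero Bicyclic) :
    bicPair (p * q) = if (bicPair p).2 ≤ (bicPair q).1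
      then ((bicPair p).1 + ((bicPair q).1 - (bicPair p).2), (bicPair q).2)
      else ((bicPair p).1, (bicPair q).2 + ((bicPair p).2 - (bicPair q).1)) := by
  induction p with
  | zero =>
    induction q with
    | zero => simp [bicPair_zero]
    | coe q =>
      simp [bicPair_zero, bicPair_coe, (natCast_lt_omega0 _).not_ge,
        natCast_add_omega0_sub_natCast]
  | coe p =>
    induction q with
    | zero =>
      simp [bicPair_zero, bicPair_coe, (natCast_lt_omega0 _).le, natCast_add_omega0_sub_natCast]
    | coe q =>
      rw [← WithZero.coe_mul, Bicyclic.mul_def]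
      simp only [bicPair_coe, Nat.cast_le, ← natCast_sub, ← Nat.cast_add]
      split_ifs with h
      · rw [min_eq_left h, Nat.add_sub_assoc h, Nat.add_sub_cancel_left]
        rfl
      · have h' := (not_le.1 h).le
        rw [min_eq_right h', Nat.add_sub_cancel, Nat.add_comm, Nat.add_sub_assoc h']
        rfl

lemma bicPair_lt {α : Ordinal} (hα : 2 ≤ α) (p : WithZero Bicyclic) :
    (bicPair p).1 < omega0 ^ α ∧ (bicPair p).2 < omega0 ^ α := by
  have h := omega0_lt_opow_of_two_le hα
  induction p with
  | zero => exact ⟨h, h⟩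
  | coe p => exact ⟨(natCast_lt_omega0 _).trans h, (natCast_lt_omega0 _).trans h⟩

lemma mem_bicSub_iff {α : Ordinal} (x : Balpha α) : x ∈ bicSub α ↔ ∃ p, bicPair p = x.1 := by
  constructor
  · rintro (⟨h₁, h₂⟩ | h)
    · obtain ⟨m, hm⟩ := lt_omega0.1 h₁
      obtain ⟨n, hn⟩ := lt_omega0.1 h₂
      exact ⟨WithZero.coe (α := Bicyclic) (m, n), Prod.ext hm.symm hn.symm⟩
    · exact ⟨0, h.symm⟩
  · rintro ⟨p, hp⟩
    induction p with
    | zero => exact Or.inr hp.symm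
    | coe p =>
      left
      rw [← hp]
      exact ⟨natCast_lt_omega0 _, natCast_lt_omega0 _⟩

/-- The bijection from the bicyclic monoid with zero onto `bicSub α`. -/
noncomputable def bicSubEquiv {α : Ordinal} (hα : 2 ≤ α) : WithZero Bicyclic ≃ bicSub α :=
  Equiv.ofBijective
    (fun p => ⟨⟨bicPair p, bicPair_lt hα p⟩, (mem_bicSub_iff _).2 ⟨p, rfl⟩⟩)
    ⟨fun _ _ h => bicPair_injective (congrArg (fun x => x.1.1) h), fun x => by
      obtain ⟨p, hp⟩ := (mem_bicSub_iff _).1 x.2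
      exact ⟨p, Subtype.ext (Subtype.ext hp)⟩⟩

lemma bicSubEquiv_val {α : Ordinal} (hα : 2 ≤ α) (p : WithZero Bicyclic) :
    (bicSubEquiv hα p).1.1 = bicPair p := rfl

/-- For `α ≥ 2` (so that `ω < ω ^ α`), the subset `{(n,m) : n, m < ω} ∪ {(ω,ω)}` of the
`α`-bicyclic monoid `B_α` is closed under multiplication, and with the induced operation
it is isomorphic to the bicyclic monoid with an adjoined zero, `(ω, ω)` being the zero. -/
theorem bicSub_iso_bicyclic_withZero (α : Ordinal) (hα : 2 ≤ α) :
    (∀ x y : Balpha α, x ∈ bicSub α → y ∈ bicSub α → x * y ∈ bicSub α) ∧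
    ∃ φ : ↥(bicSub α) → WithZero Bicyclic,
      Function.Bijective φ ∧
      φ ⟨Balpha.mk α omega0 omega0 (omega0_lt_opow_of_two_le hα) (omega0_lt_opow_of_two_le hα),
          Or.inr rfl⟩ = 0 ∧
      ∀ (x y : ↥(bicSub α)) (hxy : (x.1 * y.1) ∈ bicSub α),
        φ ⟨x.1 * y.1, hxy⟩ = φ x * φ y := by
  refine ⟨fun x y hx hy => ?_, (bicSubEquiv hα).symm, (bicSubEquiv hα).symm.bijective, ?_, ?_⟩
  · obtain ⟨p, hp⟩ := (mem_bicSub_iff x).1 hx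
    obtain ⟨q, hq⟩ := (mem_bicSub_iff y).1 hy
    exact (mem_bicSub_iff _).2 ⟨p * q, by rw [bicPair_mul, Balpha.val_mul, hp, hq]⟩
  · rw [Equiv.symm_apply_eq]
    rfl
  · intro x y hxy
    obtain ⟨p, rfl⟩ := (bicSubEquiv hα).surjective x
    obtain ⟨q, rfl⟩ := (bicSubEquiv hα).surjective y
    rw [Equiv.symm_apply_eq, Equiv.symm_apply_apply, Equiv.symm_apply_apply]
    refine Subtype.ext (Subtype.ext ?_)
    rw [Balpha.val_mul, bicSubEquiv_val, bicSubEquiv_val, bicSubEquiv_val, bicPair_mul]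
end

section
/- For every ordinal α ≤ ω, every Hausdorff locally compact topology on the α-bicyclic monoid B_α for which multiplication is jointly continuous (i.e., making B_α a locally compact topological semigroup) is the discrete topology. -/
open Ordinal

open Topology Set Filter

/-- A point `z` that is absorbing for multiplication by `u` and `v` is isolated in a locally
compact Hausdorff topological magma as soon as some neighbourhood of it consists, apart from `z`,
of isolated points `f g i j` that are arranged in grids on which `u` and `v` act by shifts. -/
theorem isOpen_singleton_of_grid {X ι : Type*} [TopologicalSpace X] [T2Space X]
    [LocallyCompactSpace X] [Mul X] (hm : Continuous fun p : X × X => p.1 * p.2)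
    {z u v : X} (f : ι → ℕ → ℕ → X) {U : Set X} (hU : U ∈ 𝓝 z)
    (hUf : ∀ x ∈ U, x = z ∨ ∃ g i j, x = f g i j)
    (hiso : ∀ g i j, IsOpen {f g i j})
    (huz : u * z = z) (hvz : v * z = z) (hzu : z * u = z) (hzv : z * v = z) (hzz : z * z = z)
    (huf : ∀ g i j, u * f g i j = f g (i + 1) j) (hvf : ∀ g i j, v * f g (i + 1) j = f g i j)
    (hfv : ∀ g i j, f g i j * v = f g i (j + 1)) (hfu : ∀ g i j, f g i (j + 1) * u = f g i j)
    (hsep : ∀ i j, ∀ᶠ x in 𝓝 z, ∀ g, x ≠ f g i j)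
    (hinj : ∀ g g' i i' j j', f g i j = f g' i' j' → i = i' ∧ j = j')
    (hff : ∀ g m, f g 0 m * f g m 0 = f g 0 0 * f g 0 0)
    (hffz : ∀ g, f g 0 0 * f g 0 0 ≠ z) : IsOpen {z} := by
  by_contra hz
  have hzf : ∀ g i j, z ≠ f g i j := fun g i j => (hsep i j).self_of_nhds g
  obtain ⟨K, hK, hKU, hKc⟩ := local_compact_nhds hU
  have key : ∀ W ∈ 𝓝 z, ∃ N : ℕ, ∀ g i j, f g i j ∈ K → (N ≤ i ∨ N ≤ j) → f g i j ∈ W := by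
    intro W hW
    have hfin : (K \ interior W).Finite := by
      have hc : IsCompact (K \ interior W) := hKc.diff isOpen_interior
      refine hc.finite (isDiscrete_iff_forall_mem_exists_isOpen.2 fun x hx => ?_)
      rcases hUf x (hKU hx.1) with rfl | ⟨g, i, j, rfl⟩
      · exact absurd (mem_interior_iff_mem_nhds.2 hW) hx.2
      · exact ⟨_, hiso g i j, by ext y; simp only [mem_inter_iff, mem_singleton_iff]; grind⟩
    have hbdd : ∀ x ∈ K \ interior W, ∃ N : ℕ, ∀ g i j, x = f g i j → i < N ∧ j < N := by
      intro x _
      by_cases h : ∃ g i j, x = f g i j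
      · obtain ⟨g, i, j, rfl⟩ := h
        refine ⟨i + j + 1, fun g' i' j' h => ?_⟩
        obtain ⟨rfl, rfl⟩ := hinj _ _ _ _ _ _ h
        omega
      · exact ⟨0, fun g i j hx => absurd ⟨g, i, j, hx⟩ h⟩
    choose! N hN using hbdd
    obtain ⟨B, hB⟩ := (hfin.image N).bddAbove
    refine ⟨B, fun g i j hfK hij => ?_⟩
    by_contra hfW
    have hmem : f g i j ∈ K \ interior W := ⟨hfK, fun h => hfW (interior_subset h)⟩
    have h₁ := hN _ hmem g i j rfl
    have h₂ := hB (mem_image_of_mem N hmem)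
    omega
  have hleft : ∀ s : X, s * z = z → ∀ᶠ x in 𝓝 z, s * x ∈ K := fun s hs =>
    ((hm.comp (Continuous.prodMk_right s)).tendsto' z z hs).eventually hK
  have hright : ∀ s : X, z * s = z → ∀ᶠ x in 𝓝 z, x * s ∈ K := fun s hs =>
    ((hm.comp (Continuous.prodMk_left s)).tendsto' z z hs).eventually hK
  obtain ⟨N, hN⟩ := key _ (((hleft u huz).and (hleft v hvz)).and ((hright u hzu).and (hright v hzv)))
  have hfar : ∀ᶠ x in 𝓝 z, ∀ i < N, ∀ j < N, ∀ g, x ≠ f g i j := by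
    have := (finite_Iio N).eventually_all.2 fun i _ =>
      (finite_Iio N).eventually_all.2 fun j _ => hsep i j
    simpa only [mem_Iio] using this
  obtain ⟨x, ⟨hxK, hxfar⟩, hxz⟩ : ∃ x, (x ∈ K ∧ ∀ i < N, ∀ j < N, ∀ g, x ≠ f g i j) ∧ x ≠ z := by
    by_contra! h
    refine hz (isOpen_singleton_iff_nhds_eq_pure z |>.2 (le_antisymm ?_ (pure_le_nhds z)))
    rw [le_pure_iff]
    filter_upwards [hK, hfar] with x h₁ h₂ using h x ⟨h₁, h₂⟩
  obtain ⟨g, i, j, rfl⟩ := (hUf x (hKU hxK)).resolve_left hxz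
  have hij : N ≤ i ∨ N ≤ j := by
    by_contra! h
    exact hxfar i h.1 j h.2 g rfl
  have hi_succ : ∀ i j, f g i j ∈ K → (N ≤ i ∨ N ≤ j) → f g (i + 1) j ∈ K := fun i j h h' =>
    huf g i j ▸ (hN g i j h h').1.1
  have hi_pred : ∀ i j, f g (i + 1) j ∈ K → (N ≤ i + 1 ∨ N ≤ j) → f g i j ∈ K := fun i j h h' =>
    hvf g i j ▸ (hN g _ j h h').1.2
  have hj_succ : ∀ i j, f g i j ∈ K → (N ≤ i ∨ N ≤ j) → f g i (j + 1) ∈ K := fun i j h h' =>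
    hfv g i j ▸ (hN g i j h h').2.2
  have hj_pred : ∀ i j, f g i (j + 1) ∈ K → (N ≤ i ∨ N ≤ j + 1) → f g i j ∈ K := fun i j h h' =>
    hfu g i j ▸ (hN g i _ h h').2.1
  have hi_add : ∀ k i j, f g i j ∈ K → (N ≤ i ∨ N ≤ j) → f g (i + k) j ∈ K := by
    intro k
    induction k with
    | zero => exact fun i j h _ => h
    | succ k ih =>
      exact fun i j h h' => hi_succ _ _ (ih i j h h')
        (h'.imp_left (·.trans (Nat.le_add_right _ _)))
  have hj_add : ∀ k i j, f g i j ∈ K → (N ≤ i ∨ N ≤ j) → f g i (j + k) ∈ K := by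
    intro k
    induction k with
    | zero => exact fun i j h _ => h
    | succ k ih =>
      exact fun i j h h' => hj_succ _ _ (ih i j h h')
        (h'.imp_right (·.trans (Nat.le_add_right _ _)))
  have hi_zero : ∀ i j, f g i j ∈ K → N ≤ j → f g 0 j ∈ K := by
    intro i j h h'
    induction i with
    | zero => exact h
    | succ i ih => exact ih (hi_pred i j h (.inr h'))
  have hj_zero : ∀ i j, f g i j ∈ K → N ≤ i → f g i 0 ∈ K := by
    intro i j h h'
    induction j with
    | zero => exact h
    | succ j ih => exact ih (hj_pred i j h (.inl h'))
  have hrow : ∀ m, f g 0 (N + j + m) ∈ K := fun m => by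
    have := hj_add (N + m) i j hxK hij
    exact hi_zero i _ (by convert this using 2; omega) (by omega)
  have hcol : ∀ m, f g (N + i + m) 0 ∈ K := fun m => by
    have := hi_add (N + m) i j hxK hij
    exact hj_zero _ j (by convert this using 2; omega) (by omega)
  have hne : ∀ᶠ p in 𝓝 z ×ˢ 𝓝 z, p.1 * p.2 ≠ f g 0 0 * f g 0 0 := by
    rw [← nhds_prod_eq]
    exact (hm.tendsto' (z, z) z hzz).eventually_ne (hffz g).symm
  obtain ⟨W, hW, hWW⟩ := Filter.eventually_prod_self_iff'.1 hne
  obtain ⟨M, hM⟩ := key W hW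
  have h₁ : f g 0 (N + i + j + M) ∈ W :=
    hM _ _ _ (by convert hrow (i + M) using 2; omega) (by omega)
  have h₂ : f g (N + i + j + M) 0 ∈ W :=
    hM _ _ _ (by convert hcol (j + M) using 2; omega) (by omega)
  exact hWW _ h₁ _ h₂ (hff g _)

namespace Ordinal

theorem omega0_opow_dvd_add_iff {a p t : Ordinal} (ht : t ≠ 0) : ω ^ a ∣ p + t ↔ ω ^ a ∣ t := by
  have h0 : ω ^ a ≠ 0 := opow_ne_zero _ omega0_ne_zero
  have hr := mod_lt p h0
  rw [← div_add_mod p (ω ^ a), add_assoc, dvd_add_iff (dvd_mul_right _ _)]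
  rcases le_or_gt (ω ^ a) t with h | h
  · rw [add_of_omega0_opow_le hr h]
  · refine ⟨fun hd => ?_, fun hd => absurd (le_of_dvd ht hd) h.not_ge⟩
    refine absurd (le_of_dvd (fun h0 => ht ?_) hd) (isPrincipal_add_omega0_opow a hr h).not_ge
    simpa using (le_add_self (a := t)).trans h0.le

theorem exists_eq_mul_add_omega0_opow {c : Ordinal} (hc : c ≠ 0) {k : ℕ}
    (hk : c < ω ^ ((k + 1 : ℕ) : Ordinal)) :
    ∃ j ≤ k, (∃ n, c = ω ^ (j : Ordinal) * n + ω ^ (j : Ordinal)) ∧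
      ¬ ω ^ ((j + 1 : ℕ) : Ordinal) ∣ c := by
  classical
  set j := Nat.findGreatest (fun j => ω ^ (j : Ordinal) ∣ c) k with hj
  have hjk : j ≤ k := Nat.findGreatest_le k
  have hjc : ω ^ (j : Ordinal) ∣ c :=
    Nat.findGreatest_spec (P := fun j => ω ^ (j : Ordinal) ∣ c) (Nat.zero_le k) (by simp)
  have hjc' : ¬ ω ^ ((j + 1 : ℕ) : Ordinal) ∣ c := by
    intro h
    rcases hjk.lt_or_eq with h' | h'
    · exact Nat.findGreatest_is_greatest (P := fun j => ω ^ (j : Ordinal) ∣ c)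
        (Nat.lt_succ_self j) h' h
    · rw [h'] at h
      exact (le_of_dvd hc h).not_gt hk
  refine ⟨j, hjk, ?_, hjc'⟩
  obtain ⟨m, hm⟩ := hjc
  have hm' : ¬ Order.IsSuccPrelimit m := by
    rw [isSuccPrelimit_iff_omega0_dvd]
    rintro ⟨l, rfl⟩
    exact hjc' ⟨l, by rw [hm, ← mul_assoc, Nat.cast_succ, ← Order.succ_eq_add_one, opow_succ]⟩
  obtain ⟨n, rfl⟩ := Order.mem_range_succ_of_not_isSuccPrelimit hm'
  exact ⟨n, by rw [hm, mul_succ]⟩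

end Ordinal

namespace Balpha

variable {α : Ordinal}

@[simp]
theorem fst_mk {a b : Ordinal} (ha : a < ω ^ α) (hb : b < ω ^ α) : (mk α a b ha hb).1.1 = a := rfl

@[simp]
theorem snd_mk {a b : Ordinal} (ha : a < ω ^ α) (hb : b < ω ^ α) : (mk α a b ha hb).1.2 = b := rfl

@[simp]
theorem fst_mul (x y : Balpha α) : (x * y).1.1 = x.1.1 + (y.1.1 - x.1.2) := by
  by_cases h : x.1.2 ≤ y.1.1
  · exact congrArg (fun z : Balpha α => z.1.1) (dif_pos h)
  · refine (congrArg (fun z : Balpha α => z.1.1) (dif_neg h)).trans ?_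
    simp [Ordinal.sub_eq_zero_iff_le.2 (not_le.1 h).le]

@[simp]
theorem snd_mul (x y : Balpha α) : (x * y).1.2 = y.1.2 + (x.1.2 - y.1.1) := by
  by_cases h : x.1.2 ≤ y.1.1
  · refine (congrArg (fun z : Balpha α => z.1.2) (dif_pos h)).trans ?_
    simp [Ordinal.sub_eq_zero_iff_le.2 h]
  · exact congrArg (fun z : Balpha α => z.1.2) (dif_neg h)

theorem ext {x y : Balpha α} (h₁ : x.1.1 = y.1.1) (h₂ : x.1.2 = y.1.2) : x = y :=
  Subtype.ext (Prod.ext h₁ h₂)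

theorem eq_mk_iff {a b : Ordinal} (ha : a < ω ^ α) (hb : b < ω ^ α) (x : Balpha α) :
    x = mk α a b ha hb ↔ x.1.1 = a ∧ x.1.2 = b :=
  ⟨by rintro rfl; exact ⟨rfl, rfl⟩, fun h => ext h.1 h.2⟩

/-- The product `(0, c) * x * (d, 0)`. -/
noncomputable def conj {c d : Ordinal} (hc : c < ω ^ α) (hd : d < ω ^ α) (x : Balpha α) :
    Balpha α :=
  mk α 0 c (opow_pos α omega0_pos) hc * x * mk α d 0 hd (opow_pos α omega0_pos)

theorem fst_conj {c d : Ordinal} (hc : c < ω ^ α) (hd : d < ω ^ α) (x : Balpha α) :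
    (conj hc hd x).1.1 = x.1.1 - c + (d - (x.1.2 + (c - x.1.1))) := by
  simp [conj]

theorem snd_conj {c d : Ordinal} (hc : c < ω ^ α) (hd : d < ω ^ α) (x : Balpha α) :
    (conj hc hd x).1.2 = x.1.2 + (c - x.1.1) - d := by
  simp [conj]

instance : One (Balpha α) := ⟨mk α 0 0 (opow_pos α omega0_pos) (opow_pos α omega0_pos)⟩

theorem conj_eq_one_iff {c d : Ordinal} (hc : c < ω ^ α) (hd : d < ω ^ α) (x : Balpha α) :
    conj hc hd x = 1 ↔ ∃ t, x.1.1 + t = c ∧ x.1.2 + t = d := by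
  refine (eq_mk_iff _ _ _).trans ?_
  rw [fst_conj, snd_conj]
  constructor
  · rintro ⟨h₁, h₂⟩
    have h₃ := le_add_self.trans h₁.le
    have h₄ := le_self_add.trans h₁.le
    rw [nonpos_iff_eq_zero, Ordinal.sub_eq_zero_iff_le] at h₃ h₄
    rw [Ordinal.sub_eq_zero_iff_le] at h₂
    exact ⟨c - x.1.1, Ordinal.add_sub_cancel_of_le h₄, h₂.antisymm h₃⟩
  · rintro ⟨t, rfl, rfl⟩
    have : x.1.1 - (x.1.1 + t) = 0 := Ordinal.sub_eq_zero_iff_le.2 le_self_add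
    simp [this]

theorem eq_of_conj_eq {a b c d : Ordinal} (hc : c < ω ^ α) (hd : d < ω ^ α) (ha : a ≠ 0)
    (hb : b ≠ 0) {x : Balpha α} (h₁ : (conj hc hd x).1.1 = a) (h₂ : (conj hc hd x).1.2 = b) :
    x.1.1 = c + a ∧ x.1.2 = d + b := by
  rw [fst_conj] at h₁
  rw [snd_conj] at h₂
  have hd' : d ≤ x.1.2 + (c - x.1.1) := by
    by_contra! h
    exact hb (h₂ ▸ Ordinal.sub_eq_zero_iff_le.2 h.le)
  rw [Ordinal.sub_eq_zero_iff_le.2 hd', add_zero] at h₁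
  have hc' : c ≤ x.1.1 := by
    by_contra! h
    exact ha (h₁ ▸ Ordinal.sub_eq_zero_iff_le.2 h.le)
  rw [Ordinal.sub_eq_zero_iff_le.2 hc', add_zero] at hd' h₂
  exact ⟨h₁ ▸ (Ordinal.add_sub_cancel_of_le hc').symm,
    h₂ ▸ (Ordinal.add_sub_cancel_of_le hd').symm⟩

section Topology

variable [TopologicalSpace (Balpha α)]

theorem continuous_conj (hm : Continuous fun p : Balpha α × Balpha α => p.1 * p.2)
    {c d : Ordinal} (hc : c < ω ^ α) (hd : d < ω ^ α) : Continuous (conj (α := α) hc hd) :=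
  hm.comp ((hm.comp (Continuous.prodMk_right _)).prodMk continuous_const)

/-- The pair `(a, b)` is an isolated point of `B_α` if it belongs to `B_α`. -/
def IsIsolated (α : Ordinal) [TopologicalSpace (Balpha α)] (a b : Ordinal) : Prop :=
  ∀ (ha : a < ω ^ α) (hb : b < ω ^ α), IsOpen {mk α a b ha hb}

theorem isOpen_singleton_one_s8 [T2Space (Balpha α)]
    (hm : Continuous fun p : Balpha α × Balpha α => p.1 * p.2) :
    IsOpen {(1 : Balpha α)} := by
  rcases eq_or_ne α 0 with rfl | hα
  · convert isOpen_univ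
    ext x
    have h₁ := x.2.1
    have h₂ := x.2.2
    simp only [opow_zero, Order.lt_one_iff] at h₁ h₂
    exact iff_of_true ((eq_mk_iff _ _ x).2 ⟨h₁, h₂⟩) trivial
  have h1 : (1 : Ordinal) < ω ^ α := one_lt_opow.2 ⟨one_lt_omega0, hα⟩
  set e := mk α 1 1 h1 h1 with he
  have h₁ : IsClosed {x | e * x = x} :=
    isClosed_eq (hm.comp (Continuous.prodMk_right e)) continuous_id
  have h₂ : IsClosed {x | x * e = x} :=
    isClosed_eq (hm.comp (Continuous.prodMk_left e)) continuous_id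
  convert (h₁.union h₂).isOpen_compl
  ext x
  have h₃ : e * x = x ↔ x.1.1 ≠ 0 := by
    refine ⟨fun h h0 => ?_, fun h => ?_⟩
    · have := congrArg (fun z : Balpha α => z.1.1) h
      simp [he, h0] at this
    · rw [← Order.one_le_iff_ne_zero] at h
      refine ext ?_ ?_
      · simpa [he] using Ordinal.add_sub_cancel_of_le h
      · simp [he, Ordinal.sub_eq_zero_iff_le.2 h]
  have h₄ : x * e = x ↔ x.1.2 ≠ 0 := by
    refine ⟨fun h h0 => ?_, fun h => ?_⟩
    · have := congrArg (fun z : Balpha α => z.1.2) h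
      simp [he, h0] at this
    · rw [← Order.one_le_iff_ne_zero] at h
      refine ext ?_ ?_
      · simp [he, Ordinal.sub_eq_zero_iff_le.2 h]
      · simpa [he] using Ordinal.add_sub_cancel_of_le h
  simp only [mem_compl_iff, mem_union, mem_ofPred_eq, h₃, h₄, not_or, not_not]
  exact eq_mk_iff _ _ x

theorem IsIsolated.add_add (hm : Continuous fun p : Balpha α × Balpha α => p.1 * p.2)
    {a b : Ordinal} (h : IsIsolated α a b) (ha : a ≠ 0) (hb : b ≠ 0) (c d : Ordinal) :
    IsIsolated α (c + a) (d + b) := by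
  intro hc hd
  have hc' := le_self_add.trans_lt hc
  have hd' := le_self_add.trans_lt hd
  convert (h (le_add_self.trans_lt hc) (le_add_self.trans_lt hd)).preimage
    (continuous_conj hm hc' hd')
  ext x
  simp only [mem_singleton_iff, mem_preimage, eq_mk_iff]
  refine ⟨?_, fun h => eq_of_conj_eq hc' hd' ha hb h.1 h.2⟩
  rintro ⟨h₁, h₂⟩
  have : c - (c + a) = 0 := Ordinal.sub_eq_zero_iff_le.2 le_self_add
  have : d - (d + b) = 0 := Ordinal.sub_eq_zero_iff_le.2 le_self_add
  simp [fst_conj, snd_conj, *]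

theorem isIsolated_of_forall [T2Space (Balpha α)]
    (hm : Continuous fun p : Balpha α × Balpha α => p.1 * p.2) {c d : Ordinal}
    (h : ∀ p q t, p + t = c → q + t = d → t = 0) : IsIsolated α c d := by
  intro hc hd
  convert (isOpen_singleton_one_s8 hm).preimage (continuous_conj hm hc hd)
  ext x
  simp only [mem_singleton_iff, mem_preimage, eq_mk_iff, conj_eq_one_iff]
  refine ⟨fun h => ⟨0, by simpa using h⟩, ?_⟩
  rintro ⟨t, h₁, h₂⟩
  obtain rfl := h _ _ _ h₁ h₂
  exact ⟨by simpa using h₁, by simpa using h₂⟩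

theorem isIsolated_of_lt [T2Space (Balpha α)]
    (hm : Continuous fun p : Balpha α × Balpha α => p.1 * p.2) {k : ℕ}
    (h : ∀ j ≤ k, IsIsolated α (ω ^ (j : Ordinal)) (ω ^ (j : Ordinal))) {c d : Ordinal}
    (hc : c < ω ^ ((k + 1 : ℕ) : Ordinal)) (hd : d < ω ^ ((k + 1 : ℕ) : Ordinal)) :
    IsIsolated α c d := by
  by_cases hcd : ∀ p q t, p + t = c → q + t = d → t = 0
  · exact isIsolated_of_forall hm hcd
  push Not at hcd
  obtain ⟨p, q, t, rfl, rfl, ht⟩ := hcd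
  have h0 : ∀ p, p + t ≠ 0 := fun p h => ht (by simpa using le_add_self.trans h.le)
  obtain ⟨i, hi, ⟨n, hn⟩, hi'⟩ := exists_eq_mul_add_omega0_opow (h0 p) hc
  obtain ⟨j, hj, ⟨m, hm'⟩, hj'⟩ := exists_eq_mul_add_omega0_opow (h0 q) hd
  have hdvd : ∀ l : ℕ, ω ^ (l : Ordinal) ∣ p + t ↔ ω ^ (l : Ordinal) ∣ q + t := fun l => by
    rw [omega0_opow_dvd_add_iff ht, omega0_opow_dvd_add_iff ht]
  have hle : ∀ {r s : ℕ}, r ≤ s → ω ^ (r : Ordinal) ∣ ω ^ (s : Ordinal) := fun h =>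
    opow_dvd_opow _ (Nat.cast_le.2 h)
  have hi_dvd : ω ^ (i : Ordinal) ∣ p + t := hn ▸ (dvd_add_iff (dvd_mul_right _ _)).2 dvd_rfl
  have hj_dvd : ω ^ (j : Ordinal) ∣ q + t := hm' ▸ (dvd_add_iff (dvd_mul_right _ _)).2 dvd_rfl
  obtain rfl : i = j := by
    by_contra hij
    rcases Nat.lt_or_gt_of_ne hij with hij | hij
    · exact hi' ((hle hij).trans ((hdvd j).2 hj_dvd))
    · exact hj' ((hle hij).trans ((hdvd i).1 hi_dvd))
  rw [hn, hm']
  have h0 : ω ^ (i : Ordinal) ≠ 0 := opow_ne_zero _ omega0_ne_zero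
  exact (h i hi).add_add hm h0 h0 _ _

theorem isIsolated_one_one [T2Space (Balpha α)]
    (hm : Continuous fun p : Balpha α × Balpha α => p.1 * p.2) :
    IsIsolated α 1 1 := by
  intro h1 _
  convert ((isOpen_singleton_one_s8 hm).preimage (continuous_conj hm h1 h1)).sdiff
    (isClosed_singleton (x := (1 : Balpha α)))
  ext x
  simp only [mem_singleton_iff, mem_preimage, eq_mk_iff, conj_eq_one_iff, Set.mem_sdiff]
  constructor
  · rintro ⟨h₁, h₂⟩
    exact ⟨⟨0, by simpa using ⟨h₁, h₂⟩⟩, by rintro rfl; exact zero_ne_one h₁⟩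
  · rintro ⟨⟨t, h₁, h₂⟩, hx⟩
    rcases eq_or_ne t 0 with rfl | ht
    · exact ⟨by simpa using h₁, by simpa using h₂⟩
    · have hlt : ∀ p : Ordinal, p + t = 1 → p = 0 := fun p hp =>
        Order.lt_one_iff.1 (hp ▸ lt_add_of_pos_right p (pos_iff_ne_zero.2 ht))
      exact absurd ((eq_mk_iff _ _ x).2 ⟨hlt _ h₁, hlt _ h₂⟩) hx

theorem IsIsolated.omega0_opow_succ [T2Space (Balpha α)] [LocallyCompactSpace (Balpha α)]
    (hm : Continuous fun p : Balpha α × Balpha α => p.1 * p.2) {k : ℕ}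
    (h : ∀ j ≤ k, IsIsolated α (ω ^ (j : Ordinal)) (ω ^ (j : Ordinal))) :
    IsIsolated α (ω ^ ((k + 1 : ℕ) : Ordinal)) (ω ^ ((k + 1 : ℕ) : Ordinal)) := by
  generalize hw' : ω ^ ((k + 1 : ℕ) : Ordinal) = w'
  intro hz _
  set w : Ordinal := ω ^ (k : Ordinal) with hw
  have hw0 : w ≠ 0 := opow_ne_zero _ omega0_ne_zero
  have hw'w : w' = w * ω := by
    rw [← hw', Nat.cast_succ, ← Order.succ_eq_add_one, opow_succ]
  have hlt : ∀ (i : ℕ) {a : Ordinal}, a < w → w * i + a < w' := by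
    intro i a ha
    calc w * i + a < w * i + w := by gcongr
      _ = w * (i + 1 : ℕ) := by rw [Nat.cast_succ, mul_add, mul_one]
      _ ≤ w * ω := by gcongr; exact (natCast_lt_omega0 _).le
      _ = _ := hw'w.symm
  have hlt' : ∀ (i : ℕ) {a : Ordinal}, a < w → w * i + a < ω ^ α := fun i a ha =>
    (hlt i ha).trans hz
  have hww : w < w' := by
    simpa using hlt 1 (pos_iff_ne_zero.2 hw0)
  have h0 : (0 : Ordinal) < ω ^ α := opow_pos α omega0_pos
  have habs : w + w' = w' := by
    subst hw'
    exact add_omega0_opow hww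
  have habs' : w' - w = w' := sub_eq_of_add_eq habs
  have hsub : w - w' = 0 := Ordinal.sub_eq_zero_iff_le.2 hww.le
  have hshift : ∀ (i : ℕ) (a : Ordinal), w + (w * i + a) = w * (i + 1 : ℕ) + a := by
    intro i a
    rw [← add_assoc]
    congr 1
    rw [add_comm i 1, Nat.cast_add, Nat.cast_one, mul_add, mul_one]
  have hunshift : ∀ (i : ℕ) (a : Ordinal), w * (i + 1 : ℕ) + a - w = w * i + a := fun i a =>
    sub_eq_of_add_eq (hshift i a)
  have hle : ∀ (i : ℕ) (a : Ordinal), w - (w * (i + 1 : ℕ) + a) = 0 := fun i a => by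
    rw [Ordinal.sub_eq_zero_iff_le, ← hshift]
    exact le_self_add
  have hinj : ∀ {i j : ℕ} {a b : Ordinal}, a < w → b < w → w * i + a = w * j + b → i = j := by
    intro i j a b ha hb hab
    have := congrArg (· / w) hab
    simpa [mul_add_div _ hw0, div_eq_zero_of_lt ha, div_eq_zero_of_lt hb] using this
  have hrep : ∀ {p t : Ordinal}, p + t = w' → t ≠ 0 → ∃ i : ℕ, p = w * i + p % w := by
    intro p t hpt ht
    have hp : p < w * ω := hw'w ▸ hpt ▸ lt_add_of_pos_right p (pos_iff_ne_zero.2 ht)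
    obtain ⟨i, hi⟩ := lt_omega0.1 ((lt_mul_iff_div_lt hw0).1 hp)
    exact ⟨i, by rw [← hi, div_add_mod]⟩
  refine isOpen_singleton_of_grid hm (ι := Iio w × Iio w) (u := mk α w 0 (hww.trans hz) h0)
    (v := mk α 0 w h0 (hww.trans hz))
    (fun g i j => mk α (w * i + g.1) (w * j + g.2) (hlt' i g.1.2) (hlt' j g.2.2))
    (((isOpen_singleton_one_s8 hm).preimage (continuous_conj hm hz hz)).mem_nhds ?_)
    ?_ ?_ ?_ ?_ ?_ ?_ ?_ ?_ ?_ ?_ ?_ ?_ ?_ ?_ ?_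
  · exact (conj_eq_one_iff _ _ _).2 ⟨0, by simp⟩
  · intro x hx
    obtain ⟨t, h₁, h₂⟩ := (conj_eq_one_iff _ _ _).1 hx
    rcases eq_or_ne t 0 with rfl | ht
    · exact .inl (ext (by simpa using h₁) (by simpa using h₂))
    · obtain ⟨i, hi⟩ := hrep h₁ ht
      obtain ⟨j, hj⟩ := hrep h₂ ht
      exact .inr ⟨(⟨_, mod_lt _ hw0⟩, ⟨_, mod_lt _ hw0⟩), i, j, ext hi hj⟩
  · exact fun g i j => isIsolated_of_lt hm h (hw' ▸ hlt i g.1.2) (hw' ▸ hlt j g.2.2) _ _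
  · exact ext (by simp [habs]) (by simp)
  · exact ext (by simp [habs']) (by simp [hsub])
  · exact ext (by simp [hsub]) (by simp [habs'])
  · exact ext (by simp) (by simp [habs])
  · exact ext (by simp) (by simp)
  · exact fun g i j => ext (by simpa using hshift i g.1) (by simp)
  · exact fun g i j => ext (by simpa using hunshift i g.1) (by simpa using hle i g.1)
  · exact fun g i j => ext (by simp) (by simpa using hshift j g.2)
  · exact fun g i j => ext (by simpa using hle j g.2) (by simpa using hunshift j g.2)
  · intro i j
    have hsucc : ∀ i : ℕ, w * (i + 1 : ℕ) < w' := fun i => by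
      simpa using hlt (i + 1) (pos_iff_ne_zero.2 hw0)
    have hadd : ∀ (i : ℕ) {a : Ordinal}, a < w → w * i + a + w = w * (i + 1 : ℕ) := by
      intro i a ha
      rw [add_assoc, add_omega0_opow ha, Nat.cast_succ, mul_add, mul_one]
    have hi := (hsucc i).trans hz
    have hj := (hsucc j).trans hz
    have hne : conj hi hj (mk α w' w' hz hz) ≠ 1 := fun hone => by
      obtain ⟨t, ht, -⟩ := (conj_eq_one_iff _ _ _).1 hone
      exact (hsucc i).not_ge (le_self_add.trans ht.le)
    filter_upwards [((continuous_conj hm hi hj).tendsto _).eventually_ne hne]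
    rintro x hx g rfl
    exact hx ((conj_eq_one_iff _ _ _).2 ⟨w, hadd i g.1.2, hadd j g.2.2⟩)
  · intro g g' i i' j j' hf
    rw [eq_mk_iff] at hf
    exact ⟨hinj g.1.2 g'.1.2 hf.1, hinj g.2.2 g'.2.2 hf.2⟩
  · intro g m
    exact ext (by simp [add_sub_add_cancel]) (by simp [add_sub_add_cancel])
  · intro g hg
    have h₁ : g.1.1 + (g.1.1 - g.2.1) = w' := by simpa using ((eq_mk_iff _ _ _).1 hg).1
    have h₂ : g.1.1 < w' := lt_trans g.1.2 hww
    have hP : IsPrincipal (· + ·) w' := hw' ▸ isPrincipal_add_omega0_opow _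
    exact (hP h₂ ((sub_le_self _ _).trans_lt h₂)).ne h₁

theorem isIsolated_omega0_opow [T2Space (Balpha α)] [LocallyCompactSpace (Balpha α)]
    (hm : Continuous fun p : Balpha α × Balpha α => p.1 * p.2) (k : ℕ) :
    IsIsolated α (ω ^ (k : Ordinal)) (ω ^ (k : Ordinal)) := by
  induction k using Nat.strong_induction_on with
  | _ k ih =>
    cases k with
    | zero => simpa using isIsolated_one_one hm
    | succ k => exact .omega0_opow_succ hm fun j hj => ih j (Nat.lt_succ_of_le hj)

end Topology

end Balpha

/-- For every ordinal `α ≤ ω`, every Hausdorff locally compact topology on the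
`α`-bicyclic monoid `B_α` with jointly continuous multiplication is discrete. -/
theorem discrete_of_locallyCompact (α : Ordinal) (hα : α ≤ omega0)
    [TopologicalSpace (Balpha α)] [T2Space (Balpha α)] [LocallyCompactSpace (Balpha α)]
    (hm : Continuous fun p : Balpha α × Balpha α => p.1 * p.2) :
    DiscreteTopology (Balpha α) := by
  have hlt : ∀ x < ω ^ α, ∃ k : ℕ, x < ω ^ (k : Ordinal) := fun x hx => by
    obtain ⟨b, hb, hxb⟩ := (lt_opow_of_isSuccLimit omega0_ne_zero isSuccLimit_omega0).1
      (hx.trans_le (opow_le_opow_right omega0_pos hα))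
    obtain ⟨k, rfl⟩ := lt_omega0.1 hb
    exact ⟨k, hxb⟩
  refine discreteTopology_iff_isOpen_singleton.2 fun ⟨⟨a, b⟩, ha, hb⟩ => ?_
  obtain ⟨k, hk⟩ := hlt a ha
  obtain ⟨l, hl⟩ := hlt b hb
  have hle : ∀ {r s : ℕ}, r ≤ s → ω ^ (r : Ordinal) ≤ ω ^ (s : Ordinal) := fun h =>
    opow_le_opow_right omega0_pos (Nat.cast_le.2 h)
  exact Balpha.isIsolated_of_lt hm (k := k + l) (fun j _ => Balpha.isIsolated_omega0_opow hm j)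
    (hk.trans_le (hle (by omega))) (hl.trans_le (hle (by omega))) ha hb
end

section
/- There exists a non-discrete, Hausdorff, locally compact topology τ on the (ω+1)-bicyclic monoid B_{ω+1} such that the multiplication map (x,y) ↦ x·y is jointly continuous and the inversion map (a,b) ↦ (b,a) is continuous; that is, (B_{ω+1}, τ) is a non-discrete locally compact topological inverse semigroup. -/
open Ordinal

open Filter Topology

namespace Balpha

universe u

/-- A set `B` containing an injective copy of a locally compact Hausdorff space `X` carries a
locally compact Hausdorff topology making this copy open and all other points isolated. -/
theorem exists_topology_of_injective {X B : Type*} [TopologicalSpace X] [T2Space X]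
    [LocallyCompactSpace X] {f : X → B} (hf : Function.Injective f) :
    ∃ _ : TopologicalSpace B, T2Space B ∧ LocallyCompactSpace B ∧
      (∀ x, 𝓝 (f x) = map f (𝓝 x)) ∧ ∀ y ∉ Set.range f, 𝓝 y = pure y := by
  classical
  let D := {y : B // y ∉ Set.range f}
  let _ : TopologicalSpace D := ⊥
  have _ : DiscreteTopology D := ⟨rfl⟩
  let E : X ⊕ D ≃ B :=
    (Equiv.sumCongr (Equiv.ofInjective f hf) (Equiv.refl D)).trans
      (Equiv.sumCompl (· ∈ Set.range f))
  let _ : TopologicalSpace B := .induced E.symm inferInstance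
  let H : B ≃ₜ X ⊕ D := E.symm.toHomeomorphOfIsInducing ⟨rfl⟩
  have hrange (x : X) : 𝓝 (f x) = map f (𝓝 x) := by
    have hx : H.symm (Sum.inl x) = f x := rfl
    rw [← hx, ← H.symm.map_nhds_eq, nhds_inl, Filter.map_map]
    rfl
  have hcompl (y : B) (hy : y ∉ Set.range f) : 𝓝 y = pure y := by
    have hy' : H.symm (Sum.inr ⟨y, hy⟩) = y := rfl
    rw [← hy', ← H.symm.map_nhds_eq, nhds_inr, nhds_discrete, Filter.map_pure, Filter.map_pure]
  have hT2 : T2Space B := H.isEmbedding.t2Space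
  have hcont : Continuous f := continuous_iff_continuousAt.2 fun x => (hrange x).ge
  have hWLC : WeaklyLocallyCompactSpace B := by
    refine ⟨fun y => ?_⟩
    by_cases hy : y ∈ Set.range f
    · obtain ⟨x, rfl⟩ := hy
      obtain ⟨K, hK, hxK⟩ := exists_compact_mem_nhds x
      exact ⟨f '' K, hK.image hcont, hrange x ▸ image_mem_map hxK⟩
    · exact ⟨{y}, isCompact_singleton, hcompl y hy ▸ mem_pure.2 rfl⟩
  exact ⟨inferInstance, hT2, inferInstance, hrange, hcompl⟩

section Arithmetic

/-- The increasing map `ℕ∞ → Ordinal` with values `ω ^ n` and `ω ^ ω`. -/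
noncomputable def omegaPow (n : ℕ∞) : Ordinal.{u} :=
  ω ^ (n.recTopCoe ω (fun k : ℕ => (k : Ordinal)) : Ordinal.{u})

theorem strictMono_omegaPow : StrictMono omegaPow.{u} := by
  intro m n h
  refine (Ordinal.opow_lt_opow_iff_right one_lt_omega0).2 ?_
  induction m with
  | top => simp at h
  | coe m =>
    induction n with
    | top => exact Ordinal.natCast_lt_omega0 m
    | coe n => exact Nat.cast_lt.2 (by exact_mod_cast h)

theorem omegaPow_pos (n : ℕ∞) : 0 < omegaPow.{u} n :=
  Ordinal.opow_pos _ omega0_pos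

theorem omegaPow_le (n : ℕ∞) : omegaPow.{u} n ≤ ω ^ ω :=
  strictMono_omegaPow.monotone le_top

theorem omegaPow_max (m n : ℕ∞) :
    omegaPow.{u} (max m n) = max (omegaPow m) (omegaPow n) :=
  strictMono_omegaPow.monotone.map_max

theorem eventually_lt_omegaPow {r : Ordinal.{u}} (hr : r < ω ^ ω) :
    ∀ᶠ n in 𝓝 (⊤ : ℕ∞), r < omegaPow n := by
  obtain ⟨b, hb, h⟩ := (lt_opow_of_isSuccLimit omega0_ne_zero isSuccLimit_omega0).1 hr
  obtain ⟨N, rfl⟩ := lt_omega0.1 hb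
  filter_upwards [lt_mem_nhds (ENat.natCast_lt_top N)] with n hn
  exact h.trans (strictMono_omegaPow hn)

theorem mul_add_one_eq (i : ℕ) :
    (ω : Ordinal.{u}) ^ (ω : Ordinal.{u}) * ((i + 1 : ℕ) : Ordinal) =
      ω ^ (ω : Ordinal.{u}) * i + ω ^ (ω : Ordinal.{u}) := by
  push_cast
  rw [mul_add, mul_one]

theorem mul_add_lt {r : Ordinal.{u}} (i : ℕ) (hr : r ≤ ω ^ ω) :
    ω ^ ω * (i : Ordinal.{u}) + r < ω ^ (ω + 1 : Ordinal.{u}) := by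
  have h : ω ^ ω * (i : Ordinal.{u}) + r ≤ ω ^ ω * ((i + 1 : ℕ) : Ordinal.{u}) := by
    rw [mul_add_one_eq]; gcongr
  refine h.trans_lt ?_
  rw [opow_add_one]
  exact (mul_lt_mul_iff_right₀ (Ordinal.opow_pos _ omega0_pos)).2 (natCast_lt_omega0 _)

theorem exists_eq_mul_add {a : Ordinal.{u}} (ha : a < ω ^ (ω + 1 : Ordinal.{u})) :
    ∃ i : ℕ, ∃ r < ω ^ ω, a = ω ^ ω * (i : Ordinal.{u}) + r := by
  rw [opow_add_one, Ordinal.lt_mul_iff] at ha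
  obtain ⟨q, hq, r, hr, rfl⟩ := ha
  obtain ⟨i, rfl⟩ := lt_omega0.1 hq
  exact ⟨i, r, hr, rfl⟩

/-- Ordinals `r, s ≤ ω ^ ω` that are both smaller than `ω ^ ω` or both equal to it. -/
def SameLevel (r s : Ordinal.{u}) : Prop :=
  (r < ω ^ ω ∧ s < ω ^ ω) ∨ (r = ω ^ ω ∧ s = ω ^ ω)

theorem sameLevel_self {r : Ordinal.{u}} (h : r ≤ ω ^ ω) : SameLevel r r :=
  h.lt_or_eq.imp (fun h => ⟨h, h⟩) fun h => ⟨h, h⟩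

/-- A common complement `w` moves `ω ^ ω * i + r` and `ω ^ ω * i + s` to `ω ^ ω * (i + q + 1)`. -/
theorem SameLevel.exists_add_eq {r s : Ordinal.{u}} (h : SameLevel r s) (q : ℕ) :
    ∃ w : Ordinal.{u}, ∀ (i : ℕ) (t : Ordinal.{u}),
      ω ^ ω * (i : Ordinal.{u}) + r + (w + t) = ω ^ ω * ((i + q + 1 : ℕ) : Ordinal.{u}) + t ∧
      ω ^ ω * (i : Ordinal.{u}) + s + (w + t) = ω ^ ω * ((i + q + 1 : ℕ) : Ordinal.{u}) + t := by
  have hq (i : ℕ) : ω ^ ω * ((i + q + 1 : ℕ) : Ordinal.{u}) =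
      ω ^ ω * (i : Ordinal.{u}) + (ω ^ ω + ω ^ ω * (q : Ordinal.{u})) := by
    rw [show i + q + 1 = i + (1 + q) by ring]
    push_cast
    rw [mul_add, mul_add, mul_one]
  rcases h with ⟨hr, hs⟩ | ⟨rfl, rfl⟩
  · refine ⟨ω ^ ω + ω ^ ω * q, fun i t => ?_⟩
    have key {r : Ordinal.{u}} (hr : r < ω ^ ω) : r + (ω ^ ω + ω ^ ω * (q : Ordinal.{u}) + t) =
        ω ^ ω + ω ^ ω * (q : Ordinal.{u}) + t :=
      add_of_omega0_opow_le hr (by rw [add_assoc]; exact le_self_add)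
    rw [hq, add_assoc, key hr, add_assoc _ s, key hs]
    simp only [add_assoc, and_self]
  · refine ⟨ω ^ ω * q, fun i t => ?_⟩
    rw [hq]
    simp only [add_assoc, and_self]

end Arithmetic

section Multiplication

theorem mul_val_of_eq_add_left {α : Ordinal.{u}} {x y : Balpha α} {z : Ordinal.{u}}
    (h : y.1.1 = x.1.2 + z) : (x * y).1 = (x.1.1 + z, y.1.2) := by
  have hle : x.1.2 ≤ y.1.1 := h ▸ le_self_add
  refine (congrArg Subtype.val (dif_pos hle)).trans ?_
  simp only [h, Ordinal.add_sub_cancel]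

theorem mul_val_of_eq_add_right {α : Ordinal.{u}} {x y : Balpha α} {z : Ordinal.{u}}
    (h : x.1.2 = y.1.1 + z) : (x * y).1 = (x.1.1, y.1.2 + z) := by
  rcases eq_or_ne z 0 with rfl | hz
  · rw [mul_val_of_eq_add_left (z := 0) (by simpa using h.symm)]
    simp
  · have hlt : y.1.1 < x.1.2 := by
      rw [h]; exact lt_add_of_pos_right _ (pos_iff_ne_zero.2 hz)
    refine (congrArg Subtype.val (dif_neg hlt.not_ge)).trans ?_
    simp only [h, Ordinal.add_sub_cancel]

/-- The inversion `(a, b) ↦ (b, a)`. -/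
def swap {α : Ordinal.{u}} (x : Balpha α) : Balpha α := ⟨(x.1.2, x.1.1), x.2.2, x.2.1⟩

theorem swap_mul {α : Ordinal.{u}} (x y : Balpha α) : swap (x * y) = swap y * swap x := by
  apply Subtype.ext
  rcases le_total x.1.2 y.1.1 with h | h
  · have e : y.1.1 = x.1.2 + (y.1.1 - x.1.2) := (Ordinal.add_sub_cancel_of_le h).symm
    rw [mul_val_of_eq_add_right (x := swap y) (y := swap x) e]
    simp [swap, mul_val_of_eq_add_left e]
  · have e : x.1.2 = y.1.1 + (x.1.2 - y.1.1) := (Ordinal.add_sub_cancel_of_le h).symm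
    rw [mul_val_of_eq_add_left (x := swap y) (y := swap x) e]
    simp [swap, mul_val_of_eq_add_right e]

/-- The elements `(ω ^ ω * i + ω ^ n, ω ^ ω * j + ω ^ n)`, which for `n → ∞` approach
`(ω ^ ω * (i + 1), ω ^ ω * (j + 1))`. -/
noncomputable def spine (p : ℕ × ℕ × ℕ∞) : Balpha.{u} (ω + 1) :=
  ⟨(ω ^ ω * (p.1 : Ordinal.{u}) + omegaPow p.2.2, ω ^ ω * (p.2.1 : Ordinal.{u}) + omegaPow p.2.2),
    mul_add_lt _ (omegaPow_le _), mul_add_lt _ (omegaPow_le _)⟩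

theorem mul_add_omegaPow_inj {i i' : ℕ} {n n' : ℕ∞}
    (h : ω ^ ω * (i : Ordinal.{u}) + omegaPow n = ω ^ ω * (i' : Ordinal.{u}) + omegaPow n') :
    i = i' ∧ n = n' := by
  have key {i i' : ℕ} {n n' : ℕ∞} (hi : i < i') :
      ω ^ ω * (i : Ordinal.{u}) + omegaPow n < ω ^ ω * (i' : Ordinal.{u}) + omegaPow n' :=
    calc ω ^ ω * (i : Ordinal.{u}) + omegaPow n
        ≤ ω ^ ω * ((i + 1 : ℕ) : Ordinal.{u}) := by
          rw [mul_add_one_eq]; gcongr; exact omegaPow_le n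
      _ ≤ ω ^ ω * (i' : Ordinal.{u}) := by gcongr; exact hi
      _ < _ := lt_add_of_pos_right _ (omegaPow_pos n')
  rcases lt_trichotomy i i' with hi | rfl | hi
  · exact absurd h (key hi).ne
  · exact ⟨rfl, strictMono_omegaPow.injective (add_left_cancel h)⟩
  · exact absurd h (key hi).ne'

theorem spine_injective : Function.Injective spine.{u} := by
  rintro ⟨i, j, n⟩ ⟨i', j', n'⟩ h
  have h' := congrArg Subtype.val h
  simp only [spine, Prod.mk.injEq] at h'
  obtain ⟨rfl, rfl⟩ := mul_add_omegaPow_inj h'.1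
  obtain ⟨rfl, -⟩ := mul_add_omegaPow_inj h'.2
  rfl

theorem spine_mul_val_of_lt {y : Balpha.{u} (ω + 1)} (i j q : ℕ) {r : Ordinal.{u}}
    (hy : y.1.1 = ω ^ ω * ((j + q + 1 : ℕ) : Ordinal.{u}) + r) (n : ℕ∞) :
    (spine (i, j, n) * y).1 = (ω ^ ω * ((i + q + 1 : ℕ) : Ordinal.{u}) + r, y.1.2) := by
  obtain ⟨w, hw⟩ := (sameLevel_self (omegaPow_le.{u} n)).exists_add_eq q
  rw [mul_val_of_eq_add_left (hy.trans (hw j r).1.symm)]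
  simp [spine, (hw i r).1]

theorem spine_mul_of_gt {y : Balpha.{u} (ω + 1)} (i q k l : ℕ) {r s : Ordinal.{u}}
    (h : SameLevel r s) (hy : y.1 = (ω ^ ω * (k : Ordinal.{u}) + r, ω ^ ω * (l : Ordinal.{u}) + s))
    (n : ℕ∞) : spine (i, k + q + 1, n) * y = spine (i, l + q + 1, n) := by
  obtain ⟨w, hw⟩ := h.exists_add_eq q
  apply Subtype.ext
  rw [mul_val_of_eq_add_right (z := w + omegaPow n)]
  · simp [spine, hy, (hw l _).2]
  · rw [hy, (hw k _).1]
    rfl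

theorem spine_mul_of_lt_omegaPow {y : Balpha.{u} (ω + 1)} (i k l : ℕ) {r s : Ordinal.{u}}
    (hy : y.1 = (ω ^ ω * (k : Ordinal.{u}) + r, ω ^ ω * (l : Ordinal.{u}) + s))
    {n : ℕ∞} (hr : r < omegaPow n) (hs : s < omegaPow n) :
    spine (i, k, n) * y = spine (i, l, n) := by
  apply Subtype.ext
  rw [mul_val_of_eq_add_right (z := omegaPow n)]
  · simp only [spine, hy, add_assoc]
    rw [omegaPow, add_omega0_opow hs]
  · simp only [spine, hy, add_assoc]
    rw [omegaPow, add_omega0_opow hr]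

theorem spine_mul_spine_self (i j l : ℕ) (n m : ℕ∞) :
    spine.{u} (i, j, n) * spine (j, l, m) = spine (i, l, max n m) := by
  apply Subtype.ext
  rcases le_total (omegaPow.{u} n) (omegaPow m) with h | h
  · rw [mul_val_of_eq_add_left (z := omegaPow m - omegaPow n)]
    · simp [spine, add_assoc, Ordinal.add_sub_cancel_of_le h, omegaPow_max, max_eq_right h]
    · simp [spine, add_assoc, Ordinal.add_sub_cancel_of_le h]
  · rw [mul_val_of_eq_add_right (z := omegaPow n - omegaPow m)]
    · simp [spine, add_assoc, Ordinal.add_sub_cancel_of_le h, omegaPow_max, max_eq_left h]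
    · simp [spine, add_assoc, Ordinal.add_sub_cancel_of_le h]

theorem exists_spine_mul_spine (i j k l : ℕ) :
    ∃ (c d : ℕ) (G : ℕ∞ × ℕ∞ → ℕ∞), Continuous G ∧
      ∀ p, spine.{u} (i, j, p.1) * spine (k, l, p.2) = spine (c, d, G p) := by
  rcases lt_trichotomy j k with h | rfl | h
  · obtain ⟨q, rfl⟩ := Nat.exists_eq_add_of_lt h
    exact ⟨i + q + 1, l, Prod.snd, continuous_snd, fun p =>
      Subtype.ext (spine_mul_val_of_lt i j q rfl p.1)⟩
  · exact ⟨i, l, fun p => max p.1 p.2, continuous_fst.max continuous_snd, fun p =>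
      spine_mul_spine_self i j l p.1 p.2⟩
  · obtain ⟨q, rfl⟩ := Nat.exists_eq_add_of_lt h
    exact ⟨i, l + q + 1, Prod.fst, continuous_fst, fun p =>
      spine_mul_of_gt i q k l (sameLevel_self (omegaPow_le p.2)) rfl p.1⟩

end Multiplication

section Continuity

variable [TopologicalSpace (Balpha.{u} (ω + 1))]

theorem continuous_spine_mul (hs : ∀ i j, Continuous fun n => spine.{u} (i, j, n))
    (i j : ℕ) (y : Balpha.{u} (ω + 1)) : Continuous fun n => spine (i, j, n) * y := by
  obtain ⟨k, r, hr, hk⟩ := exists_eq_mul_add y.2.1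
  obtain ⟨l, s, hs', hl⟩ := exists_eq_mul_add y.2.2
  have hy : y.1 = (ω ^ ω * (k : Ordinal.{u}) + r, ω ^ ω * (l : Ordinal.{u}) + s) :=
    Prod.ext hk hl
  rcases lt_trichotomy j k with h | rfl | h
  · obtain ⟨q, rfl⟩ := Nat.exists_eq_add_of_lt h
    have hc (n : ℕ∞) : spine (i, j, n) * y = spine (i, j, ⊤) * y := Subtype.ext <| by
      rw [spine_mul_val_of_lt i j q hk, spine_mul_val_of_lt i j q hk]
    simp only [hc]
    exact continuous_const
  · rw [continuous_iff_continuousAt]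
    intro n
    rcases eq_or_ne n ⊤ with rfl | hn
    · refine ((hs i l).continuousAt (x := ⊤)).congr ?_
      filter_upwards [eventually_lt_omegaPow hr, eventually_lt_omegaPow hs'] with n h₁ h₂
      exact (spine_mul_of_lt_omegaPow i j l hy h₁ h₂).symm
    · rw [ContinuousAt, ENat.nhds_eq_pure hn]
      exact tendsto_pure_nhds _ _
  · obtain ⟨q, rfl⟩ := Nat.exists_eq_add_of_lt h
    simp only [spine_mul_of_gt i q k l (.inl ⟨hr, hs'⟩) hy]
    exact hs i _

end Continuity

end Balpha

/-- There exists a non-discrete, Hausdorff, locally compact topology `τ` on the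
`(ω+1)`-bicyclic monoid `B_{ω+1}` for which multiplication is jointly continuous and
inversion `(a,b) ↦ (b,a)` is continuous; i.e. `(B_{ω+1}, τ)` is a non-discrete locally
compact topological inverse semigroup. -/
theorem exists_nondiscrete_locallyCompact_inverse_topology :
    ∃ τ : TopologicalSpace (Balpha (omega0 + 1)),
      @T2Space _ τ ∧ @LocallyCompactSpace _ τ ∧ τ ≠ ⊥ ∧
      @Continuous _ _ (@instTopologicalSpaceProd _ _ τ τ) τ
        (fun p : Balpha (omega0 + 1) × Balpha (omega0 + 1) => p.1 * p.2) ∧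
      @Continuous _ _ τ τ
        (fun x : Balpha (omega0 + 1) =>
          (⟨(x.1.2, x.1.1), x.2.2, x.2.1⟩ : Balpha (omega0 + 1))) := by
  obtain ⟨τ, hT2, hLC, hspine, hiso⟩ :=
    Balpha.exists_topology_of_injective Balpha.spine_injective
  have hnhds (i j : ℕ) (n : ℕ∞) :
      𝓝 (Balpha.spine (i, j, n)) = map (fun m => Balpha.spine (i, j, m)) (𝓝 n) := by
    rw [hspine, nhds_prod_eq, nhds_prod_eq, nhds_discrete, pure_prod, pure_prod,
      Filter.map_map, Filter.map_map]
    rfl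
  have hcont (i j : ℕ) : Continuous fun n => Balpha.spine (i, j, n) :=
    continuous_iff_continuousAt.2 fun n => (hnhds i j n).ge
  have hswap : Continuous (Balpha.swap (α := ω + 1)) := by
    rw [continuous_iff_continuousAt]
    intro x
    by_cases hx : x ∈ Set.range Balpha.spine
    · obtain ⟨⟨i, j, n⟩, rfl⟩ := hx
      rw [ContinuousAt, hnhds, tendsto_map'_iff]
      exact (hcont j i).tendsto n
    · rw [ContinuousAt, hiso x hx]
      exact tendsto_pure_nhds _ _
  refine ⟨τ, hT2, hLC, ?_, ?_, hswap⟩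
  · intro hbot
    have _ : DiscreteTopology (Balpha (omega0 + 1)) := ⟨hbot⟩
    have h : pure (Balpha.spine (0, 0, ⊤)) = map (fun m => Balpha.spine (0, 0, m)) (𝓝 ⊤) := by
      rw [← hnhds, nhds_discrete]
    have hmem : ∀ᶠ n in 𝓝 (⊤ : ℕ∞), Balpha.spine (0, 0, n) = Balpha.spine (0, 0, ⊤) := by
      have : {Balpha.spine (0, 0, ⊤)} ∈ map (fun m => Balpha.spine (0, 0, m)) (𝓝 ⊤) := by
        rw [← h]; exact mem_pure.2 rfl
      exact this
    obtain ⟨N, hN⟩ := (ENat.tendsto_natCast_nhds_top.eventually hmem).exists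
    simpa using Balpha.spine_injective hN
  · rw [continuous_iff_continuousAt]
    rintro ⟨x, y⟩
    rw [ContinuousAt, nhds_prod_eq]
    by_cases hx : x ∈ Set.range Balpha.spine
    · obtain ⟨⟨i, j, n⟩, rfl⟩ := hx
      by_cases hy : y ∈ Set.range Balpha.spine
      · obtain ⟨⟨k, l, m⟩, rfl⟩ := hy
        obtain ⟨c, d, G, hG, h⟩ := Balpha.exists_spine_mul_spine i j k l
        rw [hnhds, hnhds, prod_map_map_eq, tendsto_map'_iff, ← nhds_prod_eq]
        exact (((hcont c d).comp hG).congr fun p => (h p).symm).tendsto (n, m)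
      · rw [hiso y hy, hnhds, prod_pure, Filter.map_map, tendsto_map'_iff]
        exact (Balpha.continuous_spine_mul hcont i j y).tendsto n
    · rw [hiso x hx, pure_prod, tendsto_map'_iff]
      by_cases hy : y ∈ Set.range Balpha.spine
      · obtain ⟨⟨k, l, m⟩, rfl⟩ := hy
        rw [hnhds, tendsto_map'_iff]
        have h := hswap.comp (Balpha.continuous_spine_mul hcont l k x.swap)
        exact (h.congr fun n => Balpha.swap_mul _ _).tendsto m
      · rw [hiso y hy]
        exact tendsto_pure_nhds _ _
end
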